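/- arXiv:1912.12647 — 8 statements merged into one kernel-verified Lean document; each statement's English description precedes it below -/
import Mathlib

section
/- For all t, s, τ ∈ [0,1] one has the Harnack-type kernel inequality k(t,s) ≥ t·(1−t)·k(τ,s). -/
/-- For all `t, s, τ ∈ [0,1]` one has the Harnack-type kernel
inequality `k(t,s) ≥ t·(1−t)·k(τ,s)`. -/
theorem stmt_3 (c d : ℝ) (hc : 0 ≤ c) (hd : 0 ≤ d) (hcd : 0 < c + d)
    (k : ℝ → ℝ → ℝ)
    (hk : ∀ t s, k t s =
      if s ≤ t then s * (1 - c * t / (c + d)) else t * (1 - c * s / (c + d))) :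
    ∀ t ∈ Set.Icc (0:ℝ) 1, ∀ s ∈ Set.Icc (0:ℝ) 1, ∀ τ ∈ Set.Icc (0:ℝ) 1,
      t * (1 - t) * k τ s ≤ k t s := by
  rintro t ⟨ht0, ht1⟩ s ⟨hs0, hs1⟩ τ -
  obtain ⟨a, ha⟩ : ∃ a, a = c / (c + d) := ⟨_, rfl⟩
  have ha0 : 0 ≤ a := ha ▸ div_nonneg hc hcd.le
  have ha1 : a ≤ 1 := ha ▸ (div_le_one hcd).2 (by linarith)
  simp only [mul_div_right_comm, ← ha] at hk
  have has : 0 ≤ 1 - a * s := sub_nonneg.2 (mul_le_one₀ ha1 hs0 hs1)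
  have has1 : 1 - a * s ≤ 1 := sub_le_self _ (mul_nonneg ha0 hs0)
  have hdiag : k τ s ≤ s * (1 - a * s) := by
    rw [hk]
    split_ifs with h
    · gcongr
    · gcongr
      exact (not_le.1 h).le
  have ht : 0 ≤ 1 - t := sub_nonneg.2 ht1
  refine (mul_le_mul_of_nonneg_left hdiag (mul_nonneg ht0 ht)).trans ?_
  rw [hk]
  split_ifs
  · calc t * (1 - t) * (s * (1 - a * s)) = s * (1 - t) * (t * (1 - a * s)) := by ring
      _ ≤ s * (1 - t) :=
        mul_le_of_le_one_right (mul_nonneg hs0 ht) (mul_le_one₀ ht1 has has1)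
      _ ≤ s * (1 - a * t) := by
        gcongr
        exact mul_le_of_le_one_left ht0 ha1
  · calc t * (1 - t) * (s * (1 - a * s)) = t * (1 - a * s) * ((1 - t) * s) := by ring
      _ ≤ t * (1 - a * s) :=
        mul_le_of_le_one_right (mul_nonneg ht0 has)
          (mul_le_one₀ (by linarith) hs0 hs1)
end

section
/- The function F is continuous on [0,1] and satisfies F(t) ≥ t·(1−t)·sup_{τ∈[0,1]} F(τ) for every t ∈ [0,1]; in particular sup_{τ∈[0,1]} F(τ) ≤ 4·F(1/2). -/
open MeasureTheory Set

/-- The kernel of the boundary value problem, with `a = c / (c + d)`. -/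
def robinKernel (a t s : ℝ) : ℝ := min t s * (1 - a * max t s)

lemma continuous_uncurry_robinKernel (a : ℝ) :
    Continuous fun p : ℝ × ℝ => robinKernel a p.1 p.2 := by
  unfold robinKernel
  fun_prop

lemma robinKernel_nonneg {a t s : ℝ} (ha : a ∈ Icc (0 : ℝ) 1) (ht : t ∈ Icc (0 : ℝ) 1)
    (hs : s ∈ Icc (0 : ℝ) 1) : 0 ≤ robinKernel a t s :=
  mul_nonneg (le_min ht.1 hs.1) <| sub_nonneg.2 <|
    mul_le_one₀ ha.2 (le_max_of_le_left ht.1) (max_le ht.2 hs.2)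

lemma robinKernel_le_diag {a t s : ℝ} (ha : a ∈ Icc (0 : ℝ) 1) (hs : s ∈ Icc (0 : ℝ) 1) :
    robinKernel a t s ≤ s * (1 - a * s) := by
  obtain ⟨ha0, ha1⟩ := ha
  obtain ⟨hs0, hs1⟩ := hs
  have has : a * s ≤ 1 := mul_le_one₀ ha1 hs0 hs1
  unfold robinKernel
  rcases le_total t s with h | h
  · rw [min_eq_left h, max_eq_right h]
    exact mul_le_mul_of_nonneg_right h (sub_nonneg.2 has)
  · rw [min_eq_right h, max_eq_left h]
    gcongr

lemma robinKernel_le_one {a t s : ℝ} (ha : a ∈ Icc (0 : ℝ) 1) (hs : s ∈ Icc (0 : ℝ) 1) :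
    robinKernel a t s ≤ 1 := by
  have := mul_nonneg ha.1 hs.1
  exact (robinKernel_le_diag ha hs).trans (by nlinarith [hs.1, hs.2])

lemma mul_diag_le_robinKernel {a t s : ℝ} (ha : a ∈ Icc (0 : ℝ) 1) (ht : t ∈ Icc (0 : ℝ) 1)
    (hs : s ∈ Icc (0 : ℝ) 1) : t * (1 - t) * (s * (1 - a * s)) ≤ robinKernel a t s := by
  obtain ⟨ha0, ha1⟩ := ha
  obtain ⟨ht0, ht1⟩ := ht
  obtain ⟨hs0, hs1⟩ := hs
  have has0 : 0 ≤ a * s := mul_nonneg ha0 hs0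
  have has : 0 ≤ 1 - a * s := sub_nonneg.2 (mul_le_one₀ ha1 hs0 hs1)
  unfold robinKernel
  rcases le_total t s with h | h
  · rw [min_eq_left h, max_eq_right h]
    have h1 : (1 - t) * s ≤ 1 := mul_le_one₀ (by linarith) hs0 hs1
    calc t * (1 - t) * (s * (1 - a * s)) = t * (1 - a * s) * ((1 - t) * s) := by ring
      _ ≤ t * (1 - a * s) := mul_le_of_le_one_right (mul_nonneg ht0 has) h1
  · rw [min_eq_right h, max_eq_left h]
    have h1 : t * (1 - a * s) ≤ 1 := mul_le_one₀ ht1 has (by linarith)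
    calc t * (1 - t) * (s * (1 - a * s)) = s * (1 - t) * (t * (1 - a * s)) := by ring
      _ ≤ s * (1 - t) := mul_le_of_le_one_right (mul_nonneg hs0 (by linarith)) h1
      _ ≤ s * (1 - a * t) := by
        gcongr
        exact mul_le_of_le_one_left ht0 ha1

lemma mul_robinKernel_le {a t τ s : ℝ} (ha : a ∈ Icc (0 : ℝ) 1) (ht : t ∈ Icc (0 : ℝ) 1)
    (hs : s ∈ Icc (0 : ℝ) 1) : t * (1 - t) * robinKernel a τ s ≤ robinKernel a t s :=
  (mul_le_mul_of_nonneg_left (robinKernel_le_diag ha hs)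
    (mul_nonneg ht.1 (sub_nonneg.2 ht.2))).trans (mul_diag_le_robinKernel ha ht hs)

lemma norm_robinKernel_mul_le {a t s : ℝ} (ψ : ℝ → ℝ) (ha : a ∈ Icc (0 : ℝ) 1)
    (ht : t ∈ Icc (0 : ℝ) 1) (hs : s ∈ Icc (0 : ℝ) 1) :
    ‖robinKernel a t s * ψ s‖ ≤ ‖ψ s‖ := by
  rw [norm_mul, Real.norm_of_nonneg (robinKernel_nonneg ha ht hs)]
  exact mul_le_of_le_one_left (norm_nonneg _) (robinKernel_le_one ha hs)

lemma aestronglyMeasurable_robinKernel_mul (a t : ℝ) {ψ : ℝ → ℝ}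
    (hψ : IntegrableOn ψ (Icc 0 1)) :
    AEStronglyMeasurable (fun s => robinKernel a t s * ψ s) (volume.restrict (Icc 0 1)) :=
  ((continuous_uncurry_robinKernel a).comp
    (Continuous.prodMk_right t)).aestronglyMeasurable.mul hψ.aestronglyMeasurable

lemma integrableOn_robinKernel_mul {a t : ℝ} {ψ : ℝ → ℝ} (ha : a ∈ Icc (0 : ℝ) 1)
    (ht : t ∈ Icc (0 : ℝ) 1) (hψ : IntegrableOn ψ (Icc 0 1)) :
    IntegrableOn (fun s => robinKernel a t s * ψ s) (Icc 0 1) :=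
  Integrable.mono hψ (aestronglyMeasurable_robinKernel_mul a t hψ) <|
    ae_restrict_of_forall_mem measurableSet_Icc fun _ hs => norm_robinKernel_mul_le ψ ha ht hs

lemma continuousOn_integral_robinKernel_mul {a : ℝ} {ψ : ℝ → ℝ} (ha : a ∈ Icc (0 : ℝ) 1)
    (hψ : IntegrableOn ψ (Icc 0 1)) :
    ContinuousOn (fun t => ∫ s in Icc (0 : ℝ) 1, robinKernel a t s * ψ s) (Icc 0 1) :=
  continuousOn_of_dominated (bound := fun s => ‖ψ s‖)
    (fun t _ => aestronglyMeasurable_robinKernel_mul a t hψ)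
    (fun _ ht => ae_restrict_of_forall_mem measurableSet_Icc fun _ hs =>
      norm_robinKernel_mul_le ψ ha ht hs)
    hψ.norm
    (ae_of_all _ fun s => (((continuous_uncurry_robinKernel a).comp
      (Continuous.prodMk_left s)).mul continuous_const).continuousOn)

lemma mul_integral_robinKernel_mul_le {a t τ : ℝ} {ψ : ℝ → ℝ} (ha : a ∈ Icc (0 : ℝ) 1)
    (ht : t ∈ Icc (0 : ℝ) 1) (hτ : τ ∈ Icc (0 : ℝ) 1) (hψ0 : ∀ s ∈ Icc (0 : ℝ) 1, 0 ≤ ψ s)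
    (hψ : IntegrableOn ψ (Icc 0 1)) :
    t * (1 - t) * ∫ s in Icc (0 : ℝ) 1, robinKernel a τ s * ψ s ≤
      ∫ s in Icc (0 : ℝ) 1, robinKernel a t s * ψ s := by
  rw [← integral_const_mul]
  refine setIntegral_mono_on ((integrableOn_robinKernel_mul ha hτ hψ).const_mul _)
    (integrableOn_robinKernel_mul ha ht hψ) measurableSet_Icc fun s hs => ?_
  rw [← mul_assoc]
  exact mul_le_mul_of_nonneg_right (mul_robinKernel_le ha ht hs) (hψ0 s hs)

/-- The function `F(t) = ∫₀¹ k(t,s)·ψ(s) ds` is continuous on `[0,1]`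
and satisfies `F(t) ≥ t·(1−t)·sup_{τ∈[0,1]} F(τ)` for every `t ∈ [0,1]`;
in particular `sup_{τ∈[0,1]} F(τ) ≤ 4·F(1/2)`. -/
theorem stmt_4 (c d : ℝ) (hc : 0 ≤ c) (hd : 0 ≤ d) (hcd : 0 < c + d)
    (k : ℝ → ℝ → ℝ)
    (hk : ∀ t s, k t s =
      if s ≤ t then s * (1 - c * t / (c + d)) else t * (1 - c * s / (c + d)))
    (ψ : ℝ → ℝ) (hψ0 : ∀ s ∈ Set.Icc (0:ℝ) 1, 0 ≤ ψ s)
    (hψint : MeasureTheory.IntegrableOn ψ (Set.Icc 0 1))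
    (F : ℝ → ℝ) (hF : ∀ t, F t = ∫ s in (0:ℝ)..1, k t s * ψ s) :
    ContinuousOn F (Set.Icc 0 1) ∧
    (∀ t ∈ Set.Icc (0:ℝ) 1, t * (1 - t) * sSup (F '' Set.Icc 0 1) ≤ F t) ∧
    sSup (F '' Set.Icc 0 1) ≤ 4 * F (1/2) := by
  have ha : c / (c + d) ∈ Icc (0 : ℝ) 1 :=
    ⟨div_nonneg hc hcd.le, (div_le_one hcd).2 (le_add_of_nonneg_right hd)⟩
  have hkK : ∀ t s, k t s = robinKernel (c / (c + d)) t s := by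
    intro t s
    rw [hk, robinKernel]
    split_ifs with h
    · rw [min_eq_right h, max_eq_left h, div_mul_eq_mul_div]
    · rw [min_eq_left (not_le.1 h).le, max_eq_right (not_le.1 h).le, div_mul_eq_mul_div]
  obtain rfl : F = fun t => ∫ s in Icc (0 : ℝ) 1, robinKernel (c / (c + d)) t s * ψ s := by
    funext t
    rw [hF, intervalIntegral.integral_of_le zero_le_one, integral_Icc_eq_integral_Ioc]
    simp only [hkK]
  have hcont := continuousOn_integral_robinKernel_mul ha hψint
  obtain ⟨τ, hτ, hsup⟩ := isCompact_Icc.exists_sSup_image_eq (nonempty_Icc.2 zero_le_one) hcont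
  have hle := fun t (ht : t ∈ Icc (0 : ℝ) 1) =>
    mul_integral_robinKernel_mul_le ha ht hτ hψ0 hψint
  rw [hsup]
  refine ⟨hcont, hle, ?_⟩
  have := hle (1 / 2) (by norm_num)
  dsimp only
  linarith
end

section
/- The function F is differentiable at every t ∈ (0,1) with F′(t) = −∫₀ᵗ (c·s/(c+d))·ψ(s) ds + ∫ₜ¹ (1 − c·s/(c+d))·ψ(s) ds, and moreover t·(1−t)·|F′(t)| ≤ F(t) for every t ∈ (0,1). -/
open MeasureTheory Set in
theorem intervalIntegral_ite_le_mul {ψ : ℝ → ℝ} {u v t : ℝ} (ht : t ∈ Icc u v)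
    (hψ : IntervalIntegrable ψ volume u v) {p q : ℝ → ℝ} (hp : Continuous p)
    (hq : Continuous q) :
    ∫ s in u..v, (if s ≤ t then p s else q s) * ψ s =
      (∫ s in u..t, p s * ψ s) + ∫ s in t..v, q s * ψ s := by
  have hut : IntervalIntegrable ψ volume u t :=
    hψ.mono_set (by rw [uIcc_of_le ht.1, uIcc_of_le (ht.1.trans ht.2)]
                    exact Icc_subset_Icc le_rfl ht.2)
  have htv : IntervalIntegrable ψ volume t v :=
    hψ.mono_set (by rw [uIcc_of_le ht.2, uIcc_of_le (ht.1.trans ht.2)]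
                    exact Icc_subset_Icc ht.1 le_rfl)
  have hL : EqOn (fun s => p s * ψ s) (fun s => (if s ≤ t then p s else q s) * ψ s)
      (uIoc u t) := by
    intro s hs
    rw [uIoc_of_le ht.1] at hs
    simp [hs.2]
  have hR : EqOn (fun s => q s * ψ s) (fun s => (if s ≤ t then p s else q s) * ψ s)
      (uIoc t v) := by
    intro s hs
    rw [uIoc_of_le ht.2] at hs
    simp [not_le.2 hs.1]
  have iL := (hut.continuousOn_mul hp.continuousOn).congr hL
  have iR := (htv.continuousOn_mul hq.continuousOn).congr hR
  rw [← intervalIntegral.integral_add_adjacent_intervals iL iR,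
    intervalIntegral.integral_congr_ae (Filter.Eventually.of_forall hL),
    intervalIntegral.integral_congr_ae (Filter.Eventually.of_forall hR)]

theorem hasDerivAt_min_sub_mul {a s t : ℝ} (hst : s ≠ t) :
    HasDerivAt (fun x => min x s - a * x * s) (if s ≤ t then -(a * s) else 1 - a * s) t := by
  have hlin : HasDerivAt (fun x : ℝ => a * x * s) (a * s) t := by
    simpa using ((hasDerivAt_id t).const_mul a).mul_const s
  rcases hst.lt_or_gt with h | h
  · rw [if_pos h.le, ← zero_sub]
    refine HasDerivAt.sub ?_ hlin
    refine (hasDerivAt_const t s).congr_of_eventuallyEq ?_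
    filter_upwards [lt_mem_nhds h] with x hx using min_eq_right hx.le
  · rw [if_neg (not_le.2 h)]
    refine HasDerivAt.sub ?_ hlin
    refine (hasDerivAt_id t).congr_of_eventuallyEq ?_
    filter_upwards [gt_mem_nhds h] with x hx using min_eq_left hx.le

theorem abs_min_sub_mul_sub_le {a s : ℝ} (ha : a ∈ Set.Icc (0 : ℝ) 1)
    (hs : s ∈ Set.Icc (0 : ℝ) 1) (x y : ℝ) :
    |(min x s - a * x * s) - (min y s - a * y * s)| ≤ 2 * |x - y| := by
  have h1 : |min x s - min y s| ≤ |x - y| := by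
    simpa using abs_min_sub_min_le_max x s y s
  have h2 : |a * s * (x - y)| ≤ |x - y| := by
    rw [abs_mul, abs_of_nonneg (mul_nonneg ha.1 hs.1)]
    exact mul_le_of_le_one_left (abs_nonneg _) (mul_le_one₀ ha.2 hs.1 hs.2)
  calc |(min x s - a * x * s) - (min y s - a * y * s)|
      = |(min x s - min y s) - a * s * (x - y)| := by ring_nf
    _ ≤ |min x s - min y s| + |a * s * (x - y)| := abs_sub _ _
    _ ≤ 2 * |x - y| := by linarith

open MeasureTheory Set in
theorem hasDerivAt_integral_min_sub_mul {a : ℝ} (ha : a ∈ Icc (0 : ℝ) 1) {ψ : ℝ → ℝ}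
    (hψ : IntervalIntegrable ψ volume 0 1) (t : ℝ) :
    HasDerivAt (fun x => ∫ s in (0 : ℝ)..1, (min x s - a * x * s) * ψ s)
      (∫ s in (0 : ℝ)..1, (if s ≤ t then -(a * s) else 1 - a * s) * ψ s) t := by
  have hint (x : ℝ) :
      IntervalIntegrable (fun s => (min x s - a * x * s) * ψ s) volume 0 1 :=
    hψ.continuousOn_mul (by fun_prop)
  refine (intervalIntegral.hasDerivAt_integral_of_dominated_loc_of_lip
    (s := univ) (bound := fun s => 2 * |ψ s|) Filter.univ_mem
    (.of_forall fun x => (hint x).def'.aestronglyMeasurable) (hint t) ?_ ?_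
    (hψ.abs.const_mul 2) ?_).2
  · refine AEStronglyMeasurable.mul ?_ hψ.def'.aestronglyMeasurable
    exact (Measurable.ite measurableSet_Iic (by fun_prop) (by fun_prop)).aestronglyMeasurable
  · refine .of_forall fun s hs => LipschitzOnWith.of_dist_le_mul fun x _ y _ => ?_
    rw [uIoc_of_le zero_le_one] at hs
    have := abs_min_sub_mul_sub_le ha ⟨hs.1.le, hs.2⟩ x y
    simp only [Real.dist_eq, Real.coe_nnabs, ← sub_mul, abs_mul, abs_two, abs_abs]
    nlinarith [abs_nonneg (ψ s)]
  · filter_upwards [volume.ae_ne t] with s hs _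
    exact (hasDerivAt_min_sub_mul hs).mul_const (ψ s)

theorem mul_abs_sub_le_of_mem_Icc {a t A B : ℝ} (ha : a ∈ Set.Icc (0 : ℝ) 1)
    (ht : t ∈ Set.Icc (0 : ℝ) 1) (hA : 0 ≤ A) (hB : 0 ≤ B) :
    t * (1 - t) * |-(a * A) + B| ≤ (1 - a * t) * A + t * B := by
  obtain ⟨ha0, ha1⟩ := ha
  obtain ⟨ht0, ht1⟩ := ht
  have hat : 0 ≤ a * A := mul_nonneg ha0 hA
  have h1 : |-(a * A) + B| ≤ a * A + B := abs_le.2 ⟨by linarith, by linarith⟩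
  have h2 : t * (1 - t) * B ≤ t * B := by nlinarith [mul_nonneg (mul_nonneg ht0 ht0) hB]
  have hat_le : a * t ≤ t := mul_le_of_le_one_left ht0 ha1
  have h3 : t * (1 - t) * a ≤ 1 - a * t := by nlinarith
  calc t * (1 - t) * |-(a * A) + B|
      ≤ t * (1 - t) * (a * A + B) :=
        mul_le_mul_of_nonneg_left h1 (mul_nonneg ht0 (by linarith))
    _ = t * (1 - t) * a * A + t * (1 - t) * B := by ring
    _ ≤ (1 - a * t) * A + t * B := add_le_add (mul_le_mul_of_nonneg_right h3 hA) h2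


/-- `F` is differentiable at every `t ∈ (0,1)` with
`F′(t) = −∫₀ᵗ (c·s/(c+d))·ψ(s) ds + ∫ₜ¹ (1 − c·s/(c+d))·ψ(s) ds`, and moreover
`t·(1−t)·|F′(t)| ≤ F(t)` for every `t ∈ (0,1)`. -/
theorem stmt_5 (c d : ℝ) (hc : 0 ≤ c) (hd : 0 ≤ d) (hcd : 0 < c + d)
    (k : ℝ → ℝ → ℝ)
    (hk : ∀ t s, k t s =
      if s ≤ t then s * (1 - c * t / (c + d)) else t * (1 - c * s / (c + d)))
    (ψ : ℝ → ℝ) (hψ0 : ∀ s ∈ Set.Icc (0:ℝ) 1, 0 ≤ ψ s)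
    (hψint : MeasureTheory.IntegrableOn ψ (Set.Icc 0 1))
    (F : ℝ → ℝ) (hF : ∀ t, F t = ∫ s in (0:ℝ)..1, k t s * ψ s) :
    ∀ t ∈ Set.Ioo (0:ℝ) 1,
      HasDerivAt F
        (-(∫ s in (0:ℝ)..t, (c * s / (c + d)) * ψ s) +
          ∫ s in t..(1:ℝ), (1 - c * s / (c + d)) * ψ s) t ∧
      t * (1 - t) *
        |(-(∫ s in (0:ℝ)..t, (c * s / (c + d)) * ψ s) +
          ∫ s in t..(1:ℝ), (1 - c * s / (c + d)) * ψ s)| ≤ F t := by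
  intro t ht
  have ht' := Set.Ioo_subset_Icc_self ht
  set a := c / (c + d) with ha_def
  have ha : a ∈ Set.Icc (0 : ℝ) 1 :=
    ⟨div_nonneg hc hcd.le, (div_le_one hcd).2 (by linarith)⟩
  have hdiv (x : ℝ) : c * x / (c + d) = a * x := by rw [ha_def]; ring
  simp only [hdiv] at hk ⊢
  have hψ : IntervalIntegrable ψ MeasureTheory.volume 0 1 :=
    (intervalIntegrable_iff_integrableOn_Icc_of_le zero_le_one).2 hψint
  have hF_eq : F = fun x => ∫ s in (0 : ℝ)..1, (min x s - a * x * s) * ψ s := by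
    ext x
    rw [hF]
    congr 1 with s
    rw [hk]
    split_ifs with h
    · rw [min_eq_right h]; ring
    · rw [min_eq_left (not_le.1 h).le]; ring
  have hA : 0 ≤ ∫ s in (0 : ℝ)..t, s * ψ s :=
    intervalIntegral.integral_nonneg ht.1.le fun s hs =>
      mul_nonneg hs.1 (hψ0 s ⟨hs.1, hs.2.trans ht.2.le⟩)
  have hB : 0 ≤ ∫ s in t..(1 : ℝ), (1 - a * s) * ψ s :=
    intervalIntegral.integral_nonneg ht.2.le fun s hs => by
      have hs0 : 0 ≤ s := ht.1.le.trans hs.1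
      exact mul_nonneg (sub_nonneg.2 (mul_le_one₀ ha.2 hs0 hs.2)) (hψ0 s ⟨hs0, hs.2⟩)
  constructor
  · have hderiv := hasDerivAt_integral_min_sub_mul ha hψ t
    rw [intervalIntegral_ite_le_mul ht' hψ (by fun_prop) (by fun_prop)] at hderiv
    simpa only [hF_eq, neg_mul, intervalIntegral.integral_neg] using hderiv
  · have hFt : F t = (1 - a * t) * (∫ s in (0 : ℝ)..t, s * ψ s) +
        t * ∫ s in t..(1 : ℝ), (1 - a * s) * ψ s := by
      simp only [hF, hk]
      rw [intervalIntegral_ite_le_mul ht' hψ (by fun_prop) (by fun_prop),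
        ← intervalIntegral.integral_const_mul, ← intervalIntegral.integral_const_mul]
      congr 2 <;> ext s <;> ring
    have haA : ∫ s in (0 : ℝ)..t, a * s * ψ s = a * ∫ s in (0 : ℝ)..t, s * ψ s := by
      simp only [mul_assoc, intervalIntegral.integral_const_mul]
    rw [hFt, haA]
    exact mul_abs_sub_le_of_mem_Icc ha ht' hA hB
end

section
/- One has ‖F′‖_ω := sup_{t∈(0,1)} t·(1−t)·|F′(t)| ≤ 4·F(1/2). -/
open MeasureTheory in
/-- Comparison of weighted integrals: a pointwise bound between continuous weights on `[a, b]`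
passes to the integrals against a nonnegative integrable function. -/
theorem intervalIntegral_mul_le_of_weight_le {a b m n : ℝ} (hab : a ≤ b) {f g ψ : ℝ → ℝ}
    (hf : Continuous f) (hg : Continuous g) (hψ : IntervalIntegrable ψ volume a b)
    (hψ0 : ∀ s ∈ Set.Icc a b, 0 ≤ ψ s) (hfg : ∀ s ∈ Set.Icc a b, m * f s ≤ n * g s) :
    m * ∫ s in a..b, f s * ψ s ≤ n * ∫ s in a..b, g s * ψ s := by
  rw [← intervalIntegral.integral_const_mul, ← intervalIntegral.integral_const_mul]
  refine intervalIntegral.integral_mono_on hab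
    ((hψ.continuousOn_mul hf.continuousOn).const_mul m)
    ((hψ.continuousOn_mul hg.continuousOn).const_mul n) fun s hs => ?_
  simpa only [mul_assoc] using mul_le_mul_of_nonneg_right (hfg s hs) (hψ0 s hs)

/-- One has `‖F′‖_ω := sup_{t∈(0,1)} t·(1−t)·|F′(t)| ≤ 4·F(1/2)`,
where `F(t) = ∫₀¹ k(t,s)·ψ(s) ds` and, for `t ∈ (0,1)`,
`F′(t) = −∫₀ᵗ (c·s/(c+d))·ψ(s) ds + ∫ₜ¹ (1 − c·s/(c+d))·ψ(s) ds`. -/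
theorem stmt_6 (c d : ℝ) (hc : 0 ≤ c) (hd : 0 ≤ d) (hcd : 0 < c + d)
    (k : ℝ → ℝ → ℝ)
    (hk : ∀ t s, k t s =
      if s ≤ t then s * (1 - c * t / (c + d)) else t * (1 - c * s / (c + d)))
    (ψ : ℝ → ℝ) (hψ0 : ∀ s ∈ Set.Icc (0:ℝ) 1, 0 ≤ ψ s)
    (hψint : MeasureTheory.IntegrableOn ψ (Set.Icc 0 1))
    (F : ℝ → ℝ) (hF : ∀ t, F t = ∫ s in (0:ℝ)..1, k t s * ψ s)
    (F' : ℝ → ℝ)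
    (hF' : ∀ t ∈ Set.Ioo (0:ℝ) 1,
      F' t = -(∫ s in (0:ℝ)..t, (c * s / (c + d)) * ψ s) +
        ∫ s in t..(1:ℝ), (1 - c * s / (c + d)) * ψ s)
    (hFderiv : ∀ t ∈ Set.Ioo (0:ℝ) 1, HasDerivAt F (F' t) t) :
    sSup ((fun t => t * (1 - t) * |F' t|) '' Set.Ioo 0 1) ≤ 4 * F (1/2) := by
  obtain ⟨a, ha⟩ : ∃ a, a = c / (c + d) := ⟨_, rfl⟩
  have ha0 : 0 ≤ a := ha ▸ div_nonneg hc hcd.le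
  have ha1 : a ≤ 1 := by rw [ha, div_le_one hcd]; linarith
  have hdiv : ∀ s, c * s / (c + d) = a * s := fun s => by rw [ha]; ring
  simp only [hdiv] at hk hF'
  have hkhalf : ∀ s, k (1 / 2) s = min s (1 / 2) - a / 2 * s := by
    intro s
    rw [hk]
    split_ifs with h
    · rw [min_eq_left h]; ring
    · rw [min_eq_right (not_le.mp h).le]; ring
  have hψ : IntervalIntegrable ψ MeasureTheory.volume 0 1 :=
    (intervalIntegrable_iff_integrableOn_Icc_of_le zero_le_one).2 hψint
  have hcont : Continuous fun s : ℝ => min s (1 / 2) - a / 2 * s := by fun_prop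
  refine csSup_le ((Set.nonempty_Ioo.2 zero_lt_one).image _) ?_
  rintro _ ⟨t, ht, rfl⟩
  obtain ⟨ht0, ht1⟩ := ht
  have hψl : IntervalIntegrable ψ MeasureTheory.volume 0 t :=
    hψ.mono_set (by
      rw [Set.uIcc_of_le ht0.le, Set.uIcc_of_le zero_le_one]
      exact Set.Icc_subset_Icc_right ht1.le)
  have hψr : IntervalIntegrable ψ MeasureTheory.volume t 1 :=
    hψ.mono_set (by
      rw [Set.uIcc_of_le ht1.le, Set.uIcc_of_le zero_le_one]
      exact Set.Icc_subset_Icc_left ht0.le)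
  have hw0 : 0 ≤ t * (1 - t) := mul_nonneg ht0.le (sub_nonneg.2 ht1.le)
  have hleft : t * (1 - t) * ∫ s in (0:ℝ)..t, a * s * ψ s ≤
      4 * ∫ s in (0:ℝ)..t, (min s (1 / 2) - a / 2 * s) * ψ s := by
    refine intervalIntegral_mul_le_of_weight_le ht0.le (by fun_prop) hcont hψl
      (fun s hs => hψ0 s ⟨hs.1, hs.2.trans ht1.le⟩) ?_
    rintro s ⟨hs0, hst⟩
    have has0 : 0 ≤ a * s := mul_nonneg ha0 hs0
    have hass : a * s ≤ s := mul_le_of_le_one_left hs0 ha1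
    rcases le_total s (1 / 2) with h | h
    · rw [min_eq_left h]
      have : t * (1 - t) ≤ 1 := by nlinarith
      nlinarith
    · rw [min_eq_right h]
      have : t * (1 - t) ≤ 1 - s := by nlinarith
      nlinarith
  have hright : t * (1 - t) * ∫ s in t..(1:ℝ), (1 - a * s) * ψ s ≤
      4 * ∫ s in t..(1:ℝ), (min s (1 / 2) - a / 2 * s) * ψ s := by
    refine intervalIntegral_mul_le_of_weight_le ht1.le (by fun_prop) hcont hψr
      (fun s hs => hψ0 s ⟨ht0.le.trans hs.1, hs.2⟩) ?_
    rintro s ⟨hts, hs1⟩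
    have hs0 : 0 ≤ s := ht0.le.trans hts
    have has0 : 0 ≤ a * s := mul_nonneg ha0 hs0
    have hass : a * s ≤ s := mul_le_of_le_one_left hs0 ha1
    rcases le_total s (1 / 2) with h | h
    · rw [min_eq_left h]
      have : t * (1 - t) ≤ s := by nlinarith
      nlinarith
    · rw [min_eq_right h]
      have : t * (1 - t) ≤ 1 := by nlinarith
      nlinarith
  have hA : 0 ≤ ∫ s in (0:ℝ)..t, a * s * ψ s :=
    intervalIntegral.integral_nonneg ht0.le fun s hs =>
      mul_nonneg (mul_nonneg ha0 hs.1) (hψ0 s ⟨hs.1, hs.2.trans ht1.le⟩)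
  have hB : 0 ≤ ∫ s in t..(1:ℝ), (1 - a * s) * ψ s :=
    intervalIntegral.integral_nonneg ht1.le fun s hs =>
      mul_nonneg (sub_nonneg.2 (mul_le_one₀ ha1 (ht0.le.trans hs.1) hs.2))
        (hψ0 s ⟨ht0.le.trans hs.1, hs.2⟩)
  have hsplit := intervalIntegral.integral_add_adjacent_intervals
    (hψl.continuousOn_mul hcont.continuousOn) (hψr.continuousOn_mul hcont.continuousOn)
  have habs : |F' t| ≤
      (∫ s in (0:ℝ)..t, a * s * ψ s) + ∫ s in t..(1:ℝ), (1 - a * s) * ψ s := by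
    rw [hF' t ⟨ht0, ht1⟩, abs_le]
    constructor <;> linarith
  have hmul := mul_le_mul_of_nonneg_left habs hw0
  rw [hF]
  simp only [hkhalf]
  linarith
end

section
/- Let 0 < a ≤ b < 1 with a + b < 1, let A ≥ 0 and B ≥ 0, and define w(t) = A·γ(t) + B·δ(t) + F(t) for t ∈ [0,1]. Then w ≥ 0 on [0,1], min_{t∈[a,b]} w(t) ≥ a·sup_{t∈[0,1]} w(t), and sup_{t∈(0,1)} t·(1−t)·|w′(t)| ≤ 4·w(1/2). -/
/-- A nonnegative concave function on `[0,1]` satisfies `min t (1 - t) * f s ≤ f t`. -/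
theorem ConcaveOn.min_mul_le {f : ℝ → ℝ} (hf : ConcaveOn ℝ (Set.Icc 0 1) f)
    (h0 : ∀ t ∈ Set.Icc (0:ℝ) 1, 0 ≤ f t) {s t : ℝ}
    (hs : s ∈ Set.Icc (0:ℝ) 1) (ht : t ∈ Set.Ioo (0:ℝ) 1) :
    min t (1 - t) * f s ≤ f t := by
  obtain ⟨hs0, hs1⟩ := hs
  obtain ⟨ht0, ht1⟩ := ht
  have hfs := h0 s ⟨hs0, hs1⟩
  rcases le_total s t with hst | hts
  · have hpos : 0 < 1 - s := by linarith
    have hle : (1 - t) / (1 - s) ≤ 1 := (div_le_one hpos).2 (by linarith)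
    have hge : 1 - t ≤ (1 - t) / (1 - s) := by
      rw [le_div_iff₀ hpos]; nlinarith
    have h := hf.2 ⟨hs0, hs1⟩ (Set.right_mem_Icc.2 zero_le_one)
      (div_nonneg (by linarith) hpos.le : 0 ≤ (1 - t) / (1 - s)) (sub_nonneg.2 hle) (by ring)
    have heq : (1 - t) / (1 - s) * s + (1 - (1 - t) / (1 - s)) * 1 = t := by
      field_simp; ring
    simp only [smul_eq_mul] at h
    rw [heq] at h
    have h1 := mul_nonneg (sub_nonneg.2 hle) (h0 1 (Set.right_mem_Icc.2 zero_le_one))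
    have h2 := mul_le_mul_of_nonneg_right ((min_le_right t (1 - t)).trans hge) hfs
    linarith
  · have hpos : 0 < s := by linarith
    have hle : t / s ≤ 1 := (div_le_one hpos).2 hts
    have hge : t ≤ t / s := by
      rw [le_div_iff₀ hpos]; nlinarith
    have h := hf.2 ⟨hs0, hs1⟩ (Set.left_mem_Icc.2 zero_le_one)
      (div_nonneg ht0.le hpos.le : 0 ≤ t / s) (sub_nonneg.2 hle) (by ring)
    have heq : t / s * s + (1 - t / s) * 0 = t := by
      field_simp; ring
    simp only [smul_eq_mul] at h
    rw [heq] at h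
    have h1 := mul_nonneg (sub_nonneg.2 hle) (h0 0 (Set.left_mem_Icc.2 zero_le_one))
    have h2 := mul_le_mul_of_nonneg_right ((min_le_left t (1 - t)).trans hge) hfs
    linarith

/-- A nonnegative concave function on `[0,1]` satisfies `t * (1 - t) * |deriv f t| ≤ f t`. -/
theorem ConcaveOn.mul_abs_deriv_le {f : ℝ → ℝ} (hf : ConcaveOn ℝ (Set.Icc 0 1) f)
    (h0 : ∀ t ∈ Set.Icc (0:ℝ) 1, 0 ≤ f t) {t : ℝ} (ht : t ∈ Set.Ioo (0:ℝ) 1) :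
    t * (1 - t) * |deriv f t| ≤ f t := by
  have htI := Set.Ioo_subset_Icc_self ht
  have hft := h0 t htI
  by_cases hd : DifferentiableAt ℝ f t
  · have hl := hf.deriv_le_slope (Set.left_mem_Icc.2 zero_le_one) htI ht.1 hd
    have hr := hf.slope_le_deriv htI (Set.right_mem_Icc.2 zero_le_one) ht.2 hd
    have hf0 := h0 0 (Set.left_mem_Icc.2 zero_le_one)
    have hf1 := h0 1 (Set.right_mem_Icc.2 zero_le_one)
    obtain ⟨ht0, ht1⟩ := ht
    have hpos : 0 < 1 - t := sub_pos.2 ht1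
    rw [slope_def_field, le_div_iff₀ (by linarith)] at hl
    rw [slope_def_field, div_le_iff₀ hpos] at hr
    rcases abs_cases (deriv f t) with ⟨h, -⟩ | ⟨h, -⟩ <;> rw [h] <;> nlinarith
  · simpa [deriv_zero_of_not_differentiableAt hd] using hft

/-- Integrating a family of concave functions against a nonnegative weight gives a concave
function. -/
theorem ConcaveOn.setIntegral_mul {α : Type*} [MeasurableSpace α] {μ : MeasureTheory.Measure α}
    {T : Set α} (hT : MeasurableSet T) {S : Set ℝ} {g : ℝ → α → ℝ} {ψ : α → ℝ}
    (hS : Convex ℝ S) (hg : ∀ x ∈ T, ConcaveOn ℝ S fun t => g t x) (hψ : ∀ x ∈ T, 0 ≤ ψ x)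
    (hint : ∀ t ∈ S, MeasureTheory.IntegrableOn (fun x => g t x * ψ x) T μ) :
    ConcaveOn ℝ S fun t => ∫ x in T, g t x * ψ x ∂μ := by
  refine ⟨hS, fun x hx y hy p q hp hq hpq => ?_⟩
  simp only [smul_eq_mul]
  rw [← MeasureTheory.integral_const_mul, ← MeasureTheory.integral_const_mul,
    ← MeasureTheory.integral_add ((hint x hx).const_mul p) ((hint y hy).const_mul q)]
  refine MeasureTheory.setIntegral_mono_on (((hint x hx).const_mul p).add
    ((hint y hy).const_mul q)) (hint _ (hS hx hy hp hq hpq)) hT fun s hs => ?_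
  have h := mul_le_mul_of_nonneg_right ((hg s hs).2 hx hy hp hq hpq) (hψ s hs)
  simp only [smul_eq_mul] at h
  linarith


/-- Let `0 < a ≤ b < 1` with `a + b < 1`, let `A ≥ 0` and `B ≥ 0`, and
define `w(t) = A·γ(t) + B·δ(t) + F(t)` for `t ∈ [0,1]`. Then `w ≥ 0` on `[0,1]`,
`min_{t∈[a,b]} w(t) ≥ a·sup_{t∈[0,1]} w(t)`, and
`sup_{t∈(0,1)} t·(1−t)·|w′(t)| ≤ 4·w(1/2)`. -/
theorem stmt_7 (c d : ℝ) (hc : 0 ≤ c) (hd : 0 ≤ d) (hcd : 0 < c + d)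
    (γ : ℝ → ℝ) (hγ : ∀ t, γ t = 1 - c * t / (c + d))
    (δ : ℝ → ℝ) (hδ : ∀ t, δ t = t / (c + d))
    (k : ℝ → ℝ → ℝ)
    (hk : ∀ t s, k t s =
      if s ≤ t then s * (1 - c * t / (c + d)) else t * (1 - c * s / (c + d)))
    (ψ : ℝ → ℝ) (hψ0 : ∀ s ∈ Set.Icc (0:ℝ) 1, 0 ≤ ψ s)
    (hψint : MeasureTheory.IntegrableOn ψ (Set.Icc 0 1))
    (F : ℝ → ℝ) (hF : ∀ t, F t = ∫ s in (0:ℝ)..1, k t s * ψ s)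
    (a b : ℝ) (ha : 0 < a) (hab : a ≤ b) (hb : b < 1) (hab1 : a + b < 1)
    (A B : ℝ) (hA : 0 ≤ A) (hB : 0 ≤ B)
    (w : ℝ → ℝ) (hw : ∀ t, w t = A * γ t + B * δ t + F t) :
    (∀ t ∈ Set.Icc (0:ℝ) 1, 0 ≤ w t) ∧
    (∀ t ∈ Set.Icc a b, a * sSup (w '' Set.Icc 0 1) ≤ w t) ∧
    sSup ((fun t => t * (1 - t) * |deriv w t|) '' Set.Ioo 0 1) ≤ 4 * w (1/2) := by
  have hk' : ∀ t s, k t s = min t s - c / (c + d) * s * t := by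
    intro t s
    rw [hk]
    split_ifs with h
    · rw [min_eq_right h]; ring
    · rw [min_eq_left (not_le.1 h).le]; ring
  have hr0 : 0 ≤ c / (c + d) := div_nonneg hc hcd.le
  have hr1 : c / (c + d) ≤ 1 := (div_le_one hcd).2 (by linarith)
  have hk0 : ∀ t ∈ Set.Icc (0:ℝ) 1, ∀ s ∈ Set.Icc (0:ℝ) 1, 0 ≤ k t s := by
    rintro t ⟨ht0, ht1⟩ s ⟨hs0, hs1⟩
    have hst : c / (c + d) * s * t ≤ min t s := by
      rw [mul_assoc]
      refine (mul_le_of_le_one_left (mul_nonneg hs0 ht0) hr1).trans (le_min ?_ ?_) <;> nlinarith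
    rw [hk']
    linarith
  have hkc : ∀ s, ConcaveOn ℝ (Set.Icc (0:ℝ) 1) fun t => k t s := by
    intro s
    simp only [hk']
    exact ((concaveOn_id (convex_Icc 0 1)).inf (concaveOn_const s (convex_Icc 0 1))).sub
      ((LinearMap.mulLeft ℝ (c / (c + d) * s)).convexOn (convex_Icc 0 1))
  have hki : ∀ t ∈ Set.Icc (0:ℝ) 1,
      MeasureTheory.IntegrableOn (fun s => k t s * ψ s) (Set.Icc 0 1) := by
    intro t _
    refine hψint.continuousOn_mul ?_ isCompact_Icc
    rw [funext (hk' t)]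
    fun_prop
  have hF' : F = fun t => ∫ s in Set.Icc (0:ℝ) 1, k t s * ψ s := by
    funext t
    rw [hF, intervalIntegral.integral_of_le zero_le_one,
      MeasureTheory.integral_Icc_eq_integral_Ioc]
  have hFc : ConcaveOn ℝ (Set.Icc (0:ℝ) 1) F := by
    rw [hF']
    exact ConcaveOn.setIntegral_mul measurableSet_Icc (convex_Icc 0 1) (fun s _ => hkc s) hψ0 hki
  have hw0 : ∀ t ∈ Set.Icc (0:ℝ) 1, 0 ≤ w t := by
    intro t ht
    have hF0 : 0 ≤ F t := by
      rw [hF']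
      exact MeasureTheory.setIntegral_nonneg measurableSet_Icc fun s hs =>
        mul_nonneg (hk0 t ht s hs) (hψ0 s hs)
    have hγ0 : 0 ≤ γ t := by
      rw [hγ, mul_div_right_comm]
      nlinarith [ht.1, ht.2]
    have hδ0 : 0 ≤ δ t := by
      rw [hδ]
      exact div_nonneg ht.1 hcd.le
    rw [hw]
    positivity
  have hwc : ConcaveOn ℝ (Set.Icc (0:ℝ) 1) w := by
    refine ⟨convex_Icc 0 1, fun x hx y hy p q hp hq hpq => ?_⟩
    have h := hFc.2 hx hy hp hq hpq
    obtain rfl : q = 1 - p := by linarith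
    simp only [smul_eq_mul, hw, hγ, hδ] at h ⊢
    refine le_trans (le_of_eq ?_) (add_le_add_right h _)
    ring
  refine ⟨hw0, fun t ht => ?_, ?_⟩
  · rw [← le_div_iff₀' ha]
    refine csSup_le ((Set.nonempty_Icc.2 zero_le_one).image w) ?_
    rintro _ ⟨s, hs, rfl⟩
    rw [le_div_iff₀' ha]
    refine (mul_le_mul_of_nonneg_right (le_min ht.1 ?_) (hw0 s hs)).trans
      (hwc.min_mul_le hw0 hs ⟨ha.trans_le ht.1, ht.2.trans_lt hb⟩)
    linarith [ht.2]
  · refine csSup_le ((Set.nonempty_Ioo.2 zero_lt_one).image _) ?_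
    rintro _ ⟨t, ht, rfl⟩
    have h1 := hwc.mul_abs_deriv_le hw0 ht
    have h2 := hwc.min_mul_le hw0 (t := 1 / 2) (Set.Ioo_subset_Icc_self ht) (by norm_num)
    have h3 := hw0 (1 / 2) (by norm_num)
    norm_num at h2 h3 ⊢
    linarith
end

section
/- Suppose that for i = 1,2 and for every (w₁,w₂,z₁,z₂) ∈ [0,∞)⁴ with w_i > 0 one has f_i(w₁,w₂,z₁,z₂) < C_i·w_i. Then every solution (u,v) ∈ K₁ × K₂ of the integral system satisfies u ≡ 0 and v ≡ 0. -/
open MeasureTheory Set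

noncomputable section

/-- Green's kernel `k(t,s)` of the local problem. -/
def kern (c d : ℝ) (t s : ℝ) : ℝ :=
  if s ≤ t then s * (1 - c * t / (c + d)) else t * (1 - c * s / (c + d))

/-- `γ(t) = 1 − c·t/(c+d)`. -/
def gam (c d : ℝ) (t : ℝ) : ℝ := 1 - c * t / (c + d)

/-- `δ(t) = t/(c+d)`. -/
def del (c d : ℝ) (t : ℝ) : ℝ := t / (c + d)

/-- Membership in the cone `K` determined by `[a,b] ⊂ (0,1)` and the
functionals `A = α` and `B = β`: `w` is continuous on `[0,1]`, continuously
differentiable on `(0,1)`, nonnegative on `[0,1]`, `sup_{(0,1)} ω(t)|w'(t)|` is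
finite and `≤ 4·w(1/2)`, `min_{[a,b]} w ≥ a · sup_{[0,1]} w`, and
`α[w] ≥ 0`, `β[w] ≥ 0`. -/
def inCone (a b : ℝ) (A B : (ℝ → ℝ) →ₗ[ℝ] ℝ) (w : ℝ → ℝ) : Prop :=
  ContinuousOn w (Icc 0 1) ∧
  (∀ t ∈ Ioo (0:ℝ) 1, DifferentiableAt ℝ w t) ∧
  ContinuousOn (deriv w) (Ioo 0 1) ∧
  (∀ t ∈ Icc (0:ℝ) 1, 0 ≤ w t) ∧
  BddAbove ((fun t => t * (1 - t) * |deriv w t|) '' Ioo 0 1) ∧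
  sSup ((fun t => t * (1 - t) * |deriv w t|) '' Ioo 0 1) ≤ 4 * w (1/2) ∧
  (∀ t ∈ Icc a b, a * sSup (w '' Icc 0 1) ≤ w t) ∧
  0 ≤ A w ∧ 0 ≤ B w

/-- `(u,v)` solves the perturbed Hammerstein integral system, where
`p s = |r'(s)| = (r₀/(n−2))·s^{(n−1)/(2−n)}`. -/
def solvesSystem (c d : Fin 2 → ℝ) (A B : Fin 2 → ((ℝ → ℝ) →ₗ[ℝ] ℝ))
    (g : Fin 2 → ℝ → ℝ) (f : Fin 2 → ℝ → ℝ → ℝ → ℝ → ℝ) (p : ℝ → ℝ)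
    (u v : ℝ → ℝ) : Prop :=
  ∀ t ∈ Icc (0:ℝ) 1,
    u t = gam (c 0) (d 0) t * A 0 u + del (c 0) (d 0) t * B 0 u +
      ∫ s in (0:ℝ)..1, kern (c 0) (d 0) t s * g 0 s *
        f 0 (u s) (v s) (|deriv u s| / p s) (|deriv v s| / p s) ∧
    v t = gam (c 1) (d 1) t * A 1 v + del (c 1) (d 1) t * B 1 v +
      ∫ s in (0:ℝ)..1, kern (c 1) (d 1) t s * g 1 s *
        f 1 (u s) (v s) (|deriv u s| / p s) (|deriv v s| / p s)

/-- The constant `C_i` of the paper (`D` is the determinant `D_i`). -/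
def Cconst (c d : ℝ) (A B : (ℝ → ℝ) →ₗ[ℝ] ℝ) (g : ℝ → ℝ) (D : ℝ) : ℝ :=
  ((1 / D) * (((1 - B (del c d)) + B (gam c d) / (c + d)) *
        (∫ s in (0:ℝ)..1, A (fun t => kern c d t s) * g s) +
      (A (del c d) + (1 - A (gam c d)) / (c + d)) *
        (∫ s in (0:ℝ)..1, B (fun t => kern c d t s) * g s)) +
    sSup ((fun t => ∫ s in (0:ℝ)..1, kern c d t s * g s) '' Icc 0 1))⁻¹

/-- The constant `M_i` of the paper (`D` is the determinant `D_i`). -/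
def Mconst (c d a b : ℝ) (A B : (ℝ → ℝ) →ₗ[ℝ] ℝ) (g : ℝ → ℝ) (D : ℝ) : ℝ :=
  ((1 / D) * ((a * ((1 - B (del c d)) + B (gam c d) / (c + d))) *
        (∫ s in a..b, A (fun t => kern c d t s) * g s) +
      (a * (A (del c d) + (1 - A (gam c d)) / (c + d))) *
        (∫ s in a..b, B (fun t => kern c d t s) * g s)) +
    sInf ((fun t => ∫ s in a..b, kern c d t s * g s) '' Icc a b))⁻¹

/-- A linear functional on functions that is bounded for the sup norm on `[0,1]`, viewed as a
continuous linear functional on `C([0,1], ℝ)`. -/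
def supBoundedCLM (A : (ℝ → ℝ) →ₗ[ℝ] ℝ) (M : ℝ)
    (hA : ∀ w : ℝ → ℝ, ContinuousOn w (Icc 0 1) →
      |A w| ≤ M * sSup ((fun t => |w t|) '' Icc (0:ℝ) 1)) : C(Icc (0:ℝ) 1, ℝ) →L[ℝ] ℝ :=
  LinearMap.mkContinuous
    { toFun := fun w => A (IccExtend zero_le_one w)
      map_add' := fun v w => by rw [← map_add]; rfl
      map_smul' := fun r w => by rw [← map_smul]; rfl }
    |M| (fun w => by
      refine (hA _ (w.continuous.Icc_extend' (h := zero_le_one)).continuousOn).trans ?_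
      have hle : sSup ((fun t => |IccExtend zero_le_one w t|) '' Icc (0:ℝ) 1) ≤ ‖w‖ := by
        refine csSup_le ((nonempty_Icc.2 zero_le_one).image _) ?_
        rintro _ ⟨t, -, rfl⟩
        exact w.norm_coe_le_norm _
      have h0 : 0 ≤ sSup ((fun t => |IccExtend zero_le_one w t|) '' Icc (0:ℝ) 1) := by
        refine Real.sSup_nonneg ?_
        rintro _ ⟨t, -, rfl⟩
        exact abs_nonneg _
      exact mul_le_mul (le_abs_self M) hle h0 (abs_nonneg M))

/-- A functional bounded for the sup norm on `[0,1]` only sees values on `[0,1]`. -/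
lemma supBounded_congr {A : (ℝ → ℝ) →ₗ[ℝ] ℝ} {M : ℝ}
    (hA : ∀ w : ℝ → ℝ, ContinuousOn w (Icc 0 1) →
      |A w| ≤ M * sSup ((fun t => |w t|) '' Icc (0:ℝ) 1))
    {v w : ℝ → ℝ} (h : EqOn v w (Icc 0 1)) : A v = A w := by
  have h0 : EqOn (v - w) (fun _ => 0) (Icc 0 1) := fun t ht => by simp [h ht]
  have him : (fun t => |(v - w) t|) '' Icc (0:ℝ) 1 = {0} := by
    rw [image_congr (g := fun _ => (0:ℝ)) (fun t ht => by rw [h0 ht, abs_zero]),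
      (nonempty_Icc.2 zero_le_one).image_const]
  have hb := hA (v - w) (continuousOn_const.congr h0)
  rw [him, csSup_singleton, mul_zero] at hb
  have := abs_nonpos_iff.1 hb
  rwa [map_sub, sub_eq_zero] at this

/-- A functional bounded for the sup norm commutes with integration of a continuous kernel against
an integrable weight. -/
lemma supBounded_integral {A : (ℝ → ℝ) →ₗ[ℝ] ℝ} {M : ℝ}
    (hA : ∀ w : ℝ → ℝ, ContinuousOn w (Icc 0 1) →
      |A w| ≤ M * sSup ((fun t => |w t|) '' Icc (0:ℝ) 1))
    {k : ℝ → ℝ → ℝ} (hk : Continuous (Function.uncurry k))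
    {h : ℝ → ℝ} (hh : IntegrableOn h (Ioc 0 1)) :
    IntegrableOn (fun s => A (fun t => k t s) * h s) (Ioc 0 1) ∧
      A (fun t => ∫ s in Ioc 0 1, k t s * h s) =
        ∫ s in Ioc 0 1, A (fun t => k t s) * h s := by
  let kC : ℝ → C(Icc (0:ℝ) 1, ℝ) := fun s =>
    ⟨fun t => k t s, hk.comp (continuous_subtype_val.prodMk continuous_const)⟩
  have hkC : Continuous kC := by
    refine ContinuousMap.continuous_of_continuous_uncurry _ ?_
    exact hk.comp ((continuous_subtype_val.comp continuous_snd).prodMk continuous_fst)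
  have hint : IntegrableOn (fun s => h s • kC s) (Ioc 0 1) := by
    rw [← integrableOn_Icc_iff_integrableOn_Ioc] at hh
    exact (hh.smul_continuousOn hkC.continuousOn isCompact_Icc).mono_set Ioc_subset_Icc_self
  let φ := supBoundedCLM A M hA
  have hφ : ∀ s, φ (h s • kC s) = A (fun t => k t s) * h s := fun s => by
    rw [map_smul, smul_eq_mul, mul_comm]
    congr 1
    exact supBounded_congr hA fun t ht => IccExtend_of_mem _ _ ht
  have hcomm := φ.integral_comp_comm hint
  simp only [hφ] at hcomm
  refine ⟨(φ.integrable_comp hint).congr (.of_forall hφ), ?_⟩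
  rw [hcomm]
  refine supBounded_congr hA fun t ht => ?_
  rw [IccExtend_of_mem _ _ ht]
  have := (ContinuousMap.evalCLM ℝ (⟨t, ht⟩ : Icc (0:ℝ) 1)).integral_comp_comm hint
  simp only [ContinuousMap.evalCLM_apply] at this
  rw [← this]
  exact integral_congr_ae (.of_forall fun s => mul_comm _ _)

lemma kern_eq_min_mul (c d t s : ℝ) :
    kern c d t s = min t s * (1 - c * max t s / (c + d)) := by
  unfold kern
  split_ifs with h
  · rw [min_eq_right h, max_eq_left h]
  · rw [min_eq_left (not_le.1 h).le, max_eq_right (not_le.1 h).le]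

lemma continuous_uncurry_kern (c d : ℝ) : Continuous (Function.uncurry (kern c d)) := by
  have : Function.uncurry (kern c d) =
      fun q : ℝ × ℝ => min q.1 q.2 * (1 - c * max q.1 q.2 / (c + d)) :=
    funext fun q => kern_eq_min_mul c d q.1 q.2
  rw [this]
  fun_prop

lemma gam_mem_Icc {c d : ℝ} (hc : 0 ≤ c) (hd : 0 ≤ d) (hcd : 0 < c + d) {t : ℝ}
    (ht : t ∈ Icc (0:ℝ) 1) : gam c d t ∈ Icc (0:ℝ) 1 := by
  have h0 : 0 ≤ c * t / (c + d) := div_nonneg (mul_nonneg hc ht.1) hcd.le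
  have h1 : c * t / (c + d) ≤ 1 := (div_le_one hcd).2 (by nlinarith [ht.2])
  exact ⟨sub_nonneg.2 h1, sub_le_self _ h0⟩

lemma kern_mem_Icc {c d : ℝ} (hc : 0 ≤ c) (hd : 0 ≤ d) (hcd : 0 < c + d) {t s : ℝ}
    (ht : t ∈ Icc (0:ℝ) 1) (hs : s ∈ Icc (0:ℝ) 1) : kern c d t s ∈ Icc (0:ℝ) 1 := by
  rw [kern_eq_min_mul]
  have hm : gam c d (max t s) ∈ Icc (0:ℝ) 1 :=
    gam_mem_Icc hc hd hcd ⟨ht.1.trans (le_max_left _ _), max_le ht.2 hs.2⟩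
  exact ⟨mul_nonneg (le_min ht.1 hs.1) hm.1,
    mul_le_one₀ ((min_le_left _ _).trans ht.2) hm.1 hm.2⟩

/-- A nonnegative solution of a single perturbed Hammerstein equation whose nonlinearity lies
strictly below `C · u` vanishes identically. -/
lemma eqOn_zero_of_lt_Cconst_mul {c d : ℝ} (hc : 0 ≤ c) (hd : 0 ≤ d) (hcd : 0 < c + d)
    {g F u : ℝ → ℝ} (hg0 : ∀ s ∈ Ioc (0:ℝ) 1, 0 ≤ g s) (hg : IntegrableOn g (Ioc 0 1))
    {A B : (ℝ → ℝ) →ₗ[ℝ] ℝ}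
    (hA : ∃ M : ℝ, ∀ w : ℝ → ℝ, ContinuousOn w (Icc 0 1) →
      |A w| ≤ M * sSup ((fun t => |w t|) '' Icc (0:ℝ) 1))
    (hB : ∃ M : ℝ, ∀ w : ℝ → ℝ, ContinuousOn w (Icc 0 1) →
      |B w| ≤ M * sSup ((fun t => |w t|) '' Icc (0:ℝ) 1))
    (hAk : ∀ s ∈ Icc (0:ℝ) 1, 0 ≤ A (fun t => kern c d t s))
    (hBk : ∀ s ∈ Icc (0:ℝ) 1, 0 ≤ B (fun t => kern c d t s))
    (hAgam : A (gam c d) < 1) (hBdel : B (del c d) < 1)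
    (hAdel : 0 ≤ A (del c d)) (hBgam : 0 ≤ B (gam c d))
    {D : ℝ} (hD : D = (1 - A (gam c d)) * (1 - B (del c d)) - A (del c d) * B (gam c d))
    (hDpos : 0 < D) (hC : 0 < Cconst c d A B g D)
    (hFm : AEStronglyMeasurable F (volume.restrict (Ioc 0 1)))
    (hF0 : ∀ s ∈ Ioc (0:ℝ) 1, 0 ≤ F s)
    (hFu : ∀ s ∈ Ioc (0:ℝ) 1, 0 < u s → F s < Cconst c d A B g D * u s)
    (hFz : ∀ s ∈ Ioc (0:ℝ) 1, u s = 0 → F s = 0)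
    (hu : ContinuousOn u (Icc 0 1)) (hu0 : ∀ t ∈ Icc (0:ℝ) 1, 0 ≤ u t)
    (hAu : 0 ≤ A u) (hBu : 0 ≤ B u)
    (hsol : ∀ t ∈ Icc (0:ℝ) 1, u t = gam c d t * A u + del c d t * B u +
      ∫ s in (0:ℝ)..1, kern c d t s * g s * F s) :
    ∀ t ∈ Icc (0:ℝ) 1, u t = 0 := by
  obtain ⟨MA, hA⟩ := hA
  obtain ⟨MB, hB⟩ := hB
  obtain ⟨τ, hτ, hmax⟩ := isCompact_Icc.exists_isMaxOn (nonempty_Icc.2 zero_le_one) hu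
  have hmax' : ∀ t ∈ Icc (0:ℝ) 1, u t ≤ u τ := hmax
  rcases (hu0 τ hτ).eq_or_lt with hz | hpos
  · exact fun t ht => le_antisymm (hz ▸ hmax' t ht) (hu0 t ht)
  exfalso
  set C := Cconst c d A B g D with hCdef
  have hFlt : ∀ s ∈ Ioc (0:ℝ) 1, F s < C * u τ := fun s hs => by
    have hs' := Ioc_subset_Icc_self hs
    rcases (hu0 s hs').eq_or_lt with h | h
    · rw [hFz s hs h.symm]; positivity
    · exact (hFu s hs h).trans_le (mul_le_mul_of_nonneg_left (hmax' s hs') hC.le)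
  have hFb : ∀ᵐ s ∂volume.restrict (Ioc (0:ℝ) 1), ‖F s‖ ≤ C * u τ := by
    filter_upwards [ae_restrict_mem measurableSet_Ioc] with s hs
    rw [Real.norm_eq_abs, abs_of_nonneg (hF0 s hs)]
    exact (hFlt s hs).le
  have hmulF : ∀ {q : ℝ → ℝ}, IntegrableOn q (Ioc 0 1) →
      IntegrableOn (fun s => q s * F s) (Ioc 0 1) := fun hq => hq.mul_bdd hFm hFb
  have hk := continuous_uncurry_kern c d
  have hgF := hmulF hg
  have hkg : ∀ t, IntegrableOn (fun s => kern c d t s * g s) (Ioc 0 1) := fun t => by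
    rw [← integrableOn_Icc_iff_integrableOn_Ioc] at hg ⊢
    exact hg.continuousOn_mul (hk.comp (continuous_const.prodMk continuous_id)).continuousOn
      isCompact_Icc
  obtain ⟨hAg, -⟩ := supBounded_integral hA hk hg
  obtain ⟨hBg, -⟩ := supBounded_integral hB hk hg
  obtain ⟨-, hAG⟩ := supBounded_integral hA hk hgF
  obtain ⟨-, hBG⟩ := supBounded_integral hB hk hgF
  have hsol' : EqOn u (A u • gam c d + B u • del c d +
      fun t => ∫ s in Ioc 0 1, kern c d t s * (g s * F s)) (Icc 0 1) := fun t ht => by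
    rw [hsol t ht, intervalIntegral.integral_of_le zero_le_one]
    simp only [Pi.add_apply, Pi.smul_apply, smul_eq_mul, mul_assoc]
    ring
  have hAeq := supBounded_congr hA hsol'
  have hBeq := supBounded_congr hB hsol'
  simp only [map_add, map_smul, smul_eq_mul, hAG, hBG] at hAeq hBeq
  set kA : ℝ → ℝ := fun s => A (fun t => kern c d t s)
  set kB : ℝ → ℝ := fun s => B (fun t => kern c d t s)
  set P := (1 - B (del c d)) + B (gam c d) / (c + d) with hP
  set Q := A (del c d) + (1 - A (gam c d)) / (c + d) with hQ
  have hP0 : 0 ≤ P := add_nonneg (by linarith) (div_nonneg hBgam hcd.le)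
  have hQ0 : 0 ≤ Q := add_nonneg hAdel (div_nonneg (by linarith) hcd.le)
  let h : ℝ → ℝ := fun s => 1 / D * (P * (kA s * g s) + Q * (kB s * g s)) + kern c d τ s * g s
  have hh : IntegrableOn h (Ioc 0 1) :=
    (((hAg.const_mul P).add (hBg.const_mul Q)).const_mul _).add (hkg τ)
  have hlin : ∀ {x y z : ℝ → ℝ}, IntegrableOn x (Ioc 0 1) → IntegrableOn y (Ioc 0 1) →
      IntegrableOn z (Ioc 0 1) → ∫ s in Ioc 0 1, (1 / D * (P * x s + Q * y s) + z s) =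
        1 / D * (P * (∫ s in Ioc 0 1, x s) + Q * ∫ s in Ioc 0 1, y s) +
          ∫ s in Ioc 0 1, z s := fun {x y z} hx hy hz => by
    have hxy : IntegrableOn (fun s => P * x s + Q * y s) (Ioc 0 1) :=
      (hx.const_mul P).add (hy.const_mul Q)
    rw [integral_add (hxy.const_mul _) hz, integral_const_mul,
      integral_add (hx.const_mul P) (hy.const_mul Q), integral_const_mul, integral_const_mul]
  have hh0 : ∀ s ∈ Ioc (0:ℝ) 1, 0 ≤ h s := fun s hs => by
    have hs' := Ioc_subset_Icc_self hs
    have h1 := mul_nonneg (hAk s hs') (hg0 s hs)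
    have h2 := mul_nonneg (hBk s hs') (hg0 s hs)
    have h3 := mul_nonneg (kern_mem_Icc hc hd hcd hτ hs').1 (hg0 s hs)
    exact add_nonneg (mul_nonneg (by positivity)
      (add_nonneg (mul_nonneg hP0 h1) (mul_nonneg hQ0 h2))) h3
  have hIh : ∫ s in Ioc 0 1, h s = 1 / D * (P * (∫ s in Ioc 0 1, kA s * g s) +
      Q * ∫ s in Ioc 0 1, kB s * g s) + ∫ s in Ioc 0 1, kern c d τ s * g s :=
    hlin hAg hBg (hkg τ)
  have hIhF : ∫ s in Ioc 0 1, h s * F s =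
      1 / D * (P * (∫ s in Ioc 0 1, kA s * (g s * F s)) +
      Q * ∫ s in Ioc 0 1, kB s * (g s * F s)) +
        ∫ s in Ioc 0 1, kern c d τ s * (g s * F s) := by
    have h1 : IntegrableOn (fun s => kA s * (g s * F s)) (Ioc 0 1) := by
      simpa only [mul_assoc] using hmulF hAg
    have h2 : IntegrableOn (fun s => kB s * (g s * F s)) (Ioc 0 1) := by
      simpa only [mul_assoc] using hmulF hBg
    have h3 : IntegrableOn (fun s => kern c d τ s * (g s * F s)) (Ioc 0 1) := by
      simpa only [mul_assoc] using hmulF (hkg τ)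
    rw [← hlin h1 h2 h3]
    refine integral_congr_ae (.of_forall fun s => ?_)
    simp only [h]
    ring
  have hle : u τ ≤ ∫ s in Ioc 0 1, h s * F s := by
    have hdel : del c d τ ≤ 1 / (c + d) := div_le_div_of_nonneg_right hτ.2 hcd.le
    have hstep : u τ ≤ A u + 1 / (c + d) * B u +
        ∫ s in Ioc 0 1, kern c d τ s * (g s * F s) := by
      rw [hsol' hτ]
      simp only [Pi.add_apply, Pi.smul_apply, smul_eq_mul]
      nlinarith [mul_le_mul_of_nonneg_left hdel hBu,
        mul_le_mul_of_nonneg_left (gam_mem_Icc hc hd hcd hτ).2 hAu]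
    rw [hIhF]
    refine hstep.trans_eq ?_
    congr 1
    set IA := ∫ s in Ioc 0 1, kA s * (g s * F s)
    set IB := ∫ s in Ioc 0 1, kB s * (g s * F s)
    have e1 : A u * D = (1 - B (del c d)) * IA + A (del c d) * IB := by
      rw [hD]
      linear_combination (1 - B (del c d)) * hAeq + A (del c d) * hBeq
    have e2 : B u * D = B (gam c d) * IA + (1 - A (gam c d)) * IB := by
      rw [hD]
      linear_combination B (gam c d) * hAeq + (1 - A (gam c d)) * hBeq
    have e1' := eq_div_of_mul_eq hDpos.ne' e1
    have e2' := eq_div_of_mul_eq hDpos.ne' e2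
    rw [e1', e2', hP, hQ]
    have := hDpos.ne'
    have := hcd.ne'
    field_simp
    ring
  have hCh : C * ∫ s in Ioc 0 1, h s ≤ 1 := by
    have hbdd : BddAbove ((fun t => ∫ s in (0:ℝ)..1, kern c d t s * g s) '' Icc 0 1) := by
      refine ⟨∫ s in Ioc 0 1, g s, ?_⟩
      rintro _ ⟨t, ht, rfl⟩
      simp only [intervalIntegral.integral_of_le zero_le_one]
      refine setIntegral_mono_on (hkg t) hg measurableSet_Ioc fun s hs => ?_
      exact mul_le_of_le_one_left (hg0 s hs)
        (kern_mem_Icc hc hd hcd ht (Ioc_subset_Icc_self hs)).2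
    have hsup := le_csSup hbdd (mem_image_of_mem _ hτ)
    have hCinv : ∫ s in Ioc 0 1, h s ≤ C⁻¹ := by
      rw [hIh, hCdef, Cconst, inv_inv]
      simp only [intervalIntegral.integral_of_le zero_le_one] at hsup ⊢
      exact add_le_add le_rfl hsup
    calc C * ∫ s in Ioc 0 1, h s ≤ C * C⁻¹ := mul_le_mul_of_nonneg_left hCinv hC.le
      _ = 1 := mul_inv_cancel₀ hC.ne'
  have hgap0 : ∀ s ∈ Ioc (0:ℝ) 1, 0 ≤ h s * (C * u τ) - h s * F s := fun s hs => by
    rw [← mul_sub]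
    exact mul_nonneg (hh0 s hs) (sub_nonneg.2 (hFlt s hs).le)
  have hgapint : IntegrableOn (fun s => h s * (C * u τ) - h s * F s) (Ioc 0 1) :=
    (hh.mul_const _).sub (hmulF hh)
  have hgap : ∫ s in Ioc 0 1, (h s * (C * u τ) - h s * F s) = 0 := by
    refine le_antisymm ?_ (setIntegral_nonneg measurableSet_Ioc hgap0)
    rw [integral_sub (hh.mul_const _) (hmulF hh), integral_mul_const]
    nlinarith
  have hae := (setIntegral_eq_zero_iff_of_nonneg_ae
    ((ae_restrict_iff' measurableSet_Ioc).2 (.of_forall hgap0)) hgapint).1 hgap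
  have hzero : ∫ s in Ioc 0 1, h s * F s = 0 := by
    refine integral_eq_zero_of_ae ?_
    filter_upwards [hae, ae_restrict_mem measurableSet_Ioc] with s hs hs'
    have hs0 : h s * (C * u τ - F s) = 0 := by rw [mul_sub]; exact hs
    rcases mul_eq_zero.1 hs0 with h1 | h1
    · simp [h1]
    · exact absurd h1 (sub_pos.2 (hFlt s hs')).ne'
  linarith

/-- A nonnegative function dominated by `C · w` for `w > 0` and continuous on `[0,∞)` vanishes
at `0`. -/
lemma eq_zero_of_continuousOn_Ici_of_lt_mul {φ : ℝ → ℝ} {C : ℝ}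
    (hφ : ContinuousOn φ (Ici 0)) (h0 : 0 ≤ φ 0) (hlt : ∀ w, 0 < w → φ w < C * w) :
    φ 0 = 0 := by
  refine le_antisymm ?_ h0
  have h1 : Filter.Tendsto φ (nhdsWithin 0 (Ioi 0)) (nhds (φ 0)) :=
    (hφ 0 self_mem_Ici).mono_left (nhdsWithin_mono _ Ioi_subset_Ici_self)
  have h2 : Filter.Tendsto (fun w => C * w) (nhdsWithin 0 (Ioi 0)) (nhds (C * 0)) :=
    (Continuous.tendsto (by fun_prop) 0).mono_left nhdsWithin_le_nhds
  rw [mul_zero] at h2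
  refine le_of_tendsto_of_tendsto h1 h2 ?_
  filter_upwards [self_mem_nhdsWithin] with w hw using (hlt w hw).le

/-- nonexistence, small growth: if `f_i(w₁,w₂,z₁,z₂) < C_i·w_i`
whenever `w_i > 0` (on `[0,∞)⁴`), then the only solution of the integral system
in the cone is the zero one. -/
theorem stmt_14
    (n : ℕ) (hn : 3 ≤ n) (r₀ : ℝ) (hr₀ : 0 < r₀)
    (p : ℝ → ℝ)
    (hp : ∀ s, p s = (r₀ / ((n:ℝ) - 2)) * s ^ (((n:ℝ) - 1) / (2 - (n:ℝ))))
    (c d : Fin 2 → ℝ) (hc : ∀ i, 0 ≤ c i) (hd : ∀ i, 0 ≤ d i)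
    (hcd : ∀ i, 0 < c i + d i)
    (a b : Fin 2 → ℝ) (ha : ∀ i, 0 < a i) (hab : ∀ i, a i ≤ b i)
    (hb : ∀ i, b i < 1) (hab1 : ∀ i, a i + b i < 1)
    (g : Fin 2 → ℝ → ℝ) (hg0 : ∀ i, ∀ s ∈ Ioc (0:ℝ) 1, 0 ≤ g i s)
    (hgint : ∀ i, IntegrableOn (g i) (Ioc 0 1))
    (f : Fin 2 → ℝ → ℝ → ℝ → ℝ → ℝ)
    (hf0 : ∀ i w₁ w₂ z₁ z₂, 0 ≤ w₁ → 0 ≤ w₂ → 0 ≤ z₁ → 0 ≤ z₂ →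
      0 ≤ f i w₁ w₂ z₁ z₂)
    (hfc : ∀ i, ContinuousOn (fun q : ℝ × ℝ × ℝ × ℝ => f i q.1 q.2.1 q.2.2.1 q.2.2.2)
      {q : ℝ × ℝ × ℝ × ℝ | 0 ≤ q.1 ∧ 0 ≤ q.2.1 ∧ 0 ≤ q.2.2.1 ∧ 0 ≤ q.2.2.2})
    (A B : Fin 2 → ((ℝ → ℝ) →ₗ[ℝ] ℝ))
    (hAbdd : ∀ i, ∃ CA : ℝ, ∀ w : ℝ → ℝ, ContinuousOn w (Icc 0 1) →
      |A i w| ≤ CA * sSup ((fun t => |w t|) '' Icc (0:ℝ) 1))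
    (hBbdd : ∀ i, ∃ CB : ℝ, ∀ w : ℝ → ℝ, ContinuousOn w (Icc 0 1) →
      |B i w| ≤ CB * sSup ((fun t => |w t|) '' Icc (0:ℝ) 1))
    (hAk : ∀ i, ∀ s ∈ Icc (0:ℝ) 1, 0 ≤ A i (fun t => kern (c i) (d i) t s))
    (hBk : ∀ i, ∀ s ∈ Icc (0:ℝ) 1, 0 ≤ B i (fun t => kern (c i) (d i) t s))
    (hAkint : ∀ i, IntegrableOn
      (fun s => A i (fun t => kern (c i) (d i) t s) * g i s) (Ioc 0 1))
    (hBkint : ∀ i, IntegrableOn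
      (fun s => B i (fun t => kern (c i) (d i) t s) * g i s) (Ioc 0 1))
    (hAgam : ∀ i, 0 ≤ A i (gam (c i) (d i)) ∧ A i (gam (c i) (d i)) < 1)
    (hBdel : ∀ i, 0 ≤ B i (del (c i) (d i)) ∧ B i (del (c i) (d i)) < 1)
    (hAdel : ∀ i, 0 ≤ A i (del (c i) (d i)))
    (hBgam : ∀ i, 0 ≤ B i (gam (c i) (d i)))
    (Dv : Fin 2 → ℝ)
    (hDv : ∀ i, Dv i =
      (1 - A i (gam (c i) (d i))) * (1 - B i (del (c i) (d i))) -
        A i (del (c i) (d i)) * B i (gam (c i) (d i)))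
    (hDpos : ∀ i, 0 < Dv i)
    (Cv : Fin 2 → ℝ)
    (hCv : ∀ i, Cv i = Cconst (c i) (d i) (A i) (B i) (g i) (Dv i))
    (hsmall : ∀ w₁ w₂ z₁ z₂ : ℝ, 0 ≤ w₁ → 0 ≤ w₂ → 0 ≤ z₁ → 0 ≤ z₂ →
      (0 < w₁ → f 0 w₁ w₂ z₁ z₂ < Cv 0 * w₁) ∧
      (0 < w₂ → f 1 w₁ w₂ z₁ z₂ < Cv 1 * w₂)) :
    ∀ u v : ℝ → ℝ,
      inCone (a 0) (b 0) (A 0) (B 0) u → inCone (a 1) (b 1) (A 1) (B 1) v →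
      solvesSystem c d A B g f p u v →
      ∀ t ∈ Icc (0:ℝ) 1, u t = 0 ∧ v t = 0 := by
  intro u v hu hv hsol
  obtain ⟨huc, hud, hudc, hu0, -, -, -, hAu, hBu⟩ := hu
  obtain ⟨hvc, hvd, hvdc, hv0, -, -, -, hAv, hBv⟩ := hv
  have hp0 : ∀ s, 0 < s → 0 < p s := fun s hs => by
    have hn' : (3:ℝ) ≤ n := by exact_mod_cast hn
    rw [hp]
    exact mul_pos (div_pos hr₀ (by linarith)) (Real.rpow_pos_of_pos hs _)
  have hz0 : ∀ (w : ℝ → ℝ), ∀ s ∈ Ioc (0:ℝ) 1, 0 ≤ |deriv w s| / p s := fun w s hs =>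
    div_nonneg (abs_nonneg _) (hp0 s hs.1).le
  have hpc : ContinuousOn p (Ioo 0 1) := by
    rw [funext hp]
    exact continuousOn_const.mul
      (continuousOn_id.rpow_const fun s hs => Or.inl (ne_of_gt hs.1))
  have hFm : ∀ i, AEStronglyMeasurable
      (fun s => f i (u s) (v s) (|deriv u s| / p s) (|deriv v s| / p s))
      (volume.restrict (Ioc 0 1)) := fun i => by
    rw [← restrict_Ioo_eq_restrict_Ioc]
    refine ContinuousOn.aestronglyMeasurable ?_ measurableSet_Ioo
    have hpne : ∀ s ∈ Ioo (0:ℝ) 1, p s ≠ 0 := fun s hs => (hp0 s hs.1).ne'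
    refine (hfc i).comp ((huc.mono Ioo_subset_Icc_self).prodMk
      ((hvc.mono Ioo_subset_Icc_self).prodMk
        ((hudc.abs.div hpc hpne).prodMk (hvdc.abs.div hpc hpne)))) fun s hs => ?_
    exact ⟨hu0 s (Ioo_subset_Icc_self hs), hv0 s (Ioo_subset_Icc_self hs),
      hz0 u s (Ioo_subset_Ioc_self hs), hz0 v s (Ioo_subset_Ioc_self hs)⟩
  have hC0 : 0 < Cv 0 := by
    have := (hsmall 1 1 0 0 zero_le_one zero_le_one le_rfl le_rfl).1 one_pos
    linarith [hf0 0 1 1 0 0 zero_le_one zero_le_one le_rfl le_rfl]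
  have hC1 : 0 < Cv 1 := by
    have := (hsmall 1 1 0 0 zero_le_one zero_le_one le_rfl le_rfl).2 one_pos
    linarith [hf0 1 1 1 0 0 zero_le_one zero_le_one le_rfl le_rfl]
  have hfz0 : ∀ w₂ z₁ z₂, 0 ≤ w₂ → 0 ≤ z₁ → 0 ≤ z₂ → f 0 0 w₂ z₁ z₂ = 0 :=
    fun w₂ z₁ z₂ h2 h3 h4 =>
      eq_zero_of_continuousOn_Ici_of_lt_mul (φ := fun w => f 0 w w₂ z₁ z₂)
        ((hfc 0).comp (f := fun w : ℝ => (w, w₂, z₁, z₂)) (by fun_prop)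
          fun w hw => ⟨hw, h2, h3, h4⟩)
        (hf0 0 _ _ _ _ le_rfl h2 h3 h4) fun w hw => (hsmall w w₂ z₁ z₂ hw.le h2 h3 h4).1 hw
  have hfz1 : ∀ w₁ z₁ z₂, 0 ≤ w₁ → 0 ≤ z₁ → 0 ≤ z₂ → f 1 w₁ 0 z₁ z₂ = 0 :=
    fun w₁ z₁ z₂ h1 h3 h4 =>
      eq_zero_of_continuousOn_Ici_of_lt_mul (φ := fun w => f 1 w₁ w z₁ z₂)
        ((hfc 1).comp (f := fun w : ℝ => (w₁, w, z₁, z₂)) (by fun_prop)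
          fun w hw => ⟨h1, hw, h3, h4⟩)
        (hf0 1 _ _ _ _ h1 le_rfl h3 h4) fun w hw => (hsmall w₁ w z₁ z₂ h1 hw.le h3 h4).2 hw
  have hF0 : ∀ i, ∀ s ∈ Ioc (0:ℝ) 1,
      0 ≤ f i (u s) (v s) (|deriv u s| / p s) (|deriv v s| / p s) := fun i s hs =>
    hf0 i _ _ _ _ (hu0 s (Ioc_subset_Icc_self hs)) (hv0 s (Ioc_subset_Icc_self hs))
      (hz0 u s hs) (hz0 v s hs)
  have hlt := fun s (hs : s ∈ Ioc (0:ℝ) 1) => hsmall (u s) (v s) _ _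
    (hu0 s (Ioc_subset_Icc_self hs)) (hv0 s (Ioc_subset_Icc_self hs)) (hz0 u s hs) (hz0 v s hs)
  rw [hCv 0] at hC0
  rw [hCv 1] at hC1
  rw [hCv 0, hCv 1] at hlt
  have hu_zero := eqOn_zero_of_lt_Cconst_mul (hc 0) (hd 0) (hcd 0) (hg0 0) (hgint 0)
    (hAbdd 0) (hBbdd 0) (hAk 0) (hBk 0) (hAgam 0).2 (hBdel 0).2 (hAdel 0) (hBgam 0)
    (hDv 0) (hDpos 0) hC0 (hFm 0) (hF0 0) (fun s hs => (hlt s hs).1)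
    (fun s hs h => by
      simp only [h]
      exact hfz0 _ _ _ (hv0 s (Ioc_subset_Icc_self hs)) (hz0 u s hs) (hz0 v s hs))
    huc hu0 hAu hBu fun t ht => (hsol t ht).1
  have hv_zero := eqOn_zero_of_lt_Cconst_mul (hc 1) (hd 1) (hcd 1) (hg0 1) (hgint 1)
    (hAbdd 1) (hBbdd 1) (hAk 1) (hBk 1) (hAgam 1).2 (hBdel 1).2 (hAdel 1) (hBgam 1)
    (hDv 1) (hDpos 1) hC1 (hFm 1) (hF0 1) (fun s hs => (hlt s hs).2)
    (fun s hs h => by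
      simp only [h]
      exact hfz1 _ _ _ (hu0 s (Ioc_subset_Icc_self hs)) (hz0 u s hs) (hz0 v s hs))
    hvc hv0 hAv hBv fun t ht => (hsol t ht).2
  exact fun t ht => ⟨hu_zero t ht, hv_zero t ht⟩

end
end

section
/- Suppose in addition c > 0 or d > 0 (i.e. c + d > 0). Then sup_{t∈[0,1]} ∫₀¹ k(t,s) ds = (c + 2d)² / (8·(c + d)²). -/
open intervalIntegral in
/-- The row integrals of the kernel `s ∧ t - a s t` are the parabola `(1 - a / 2) t - t² / 2`. -/
theorem integral_min_sub_mul (a t : ℝ) (ht : t ∈ Set.Icc (0 : ℝ) 1) :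
    (∫ s in (0 : ℝ)..1, if s ≤ t then s * (1 - a * t) else t * (1 - a * s)) =
      (1 - a / 2) * t - t ^ 2 / 2 := by
  have hleft : Set.EqOn (fun s => if s ≤ t then s * (1 - a * t) else t * (1 - a * s))
      (fun s => s * (1 - a * t)) (Set.uIcc 0 t) := by
    intro s hs
    rw [Set.uIcc_of_le ht.1] at hs
    simp [hs.2]
  have hright : Set.EqOn (fun s => if s ≤ t then s * (1 - a * t) else t * (1 - a * s))
      (fun s => t * (1 - a * s)) (Set.uIcc t 1) := by
    intro s hs
    rw [Set.uIcc_of_le ht.2] at hs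
    rcases hs.1.eq_or_lt with rfl | h
    · simp
    · simp [h.not_ge]
  have hint_left : IntervalIntegrable
      (fun s => if s ≤ t then s * (1 - a * t) else t * (1 - a * s)) MeasureTheory.volume 0 t :=
    (ContinuousOn.congr (by fun_prop) hleft).intervalIntegrable
  have hint_right : IntervalIntegrable
      (fun s => if s ≤ t then s * (1 - a * t) else t * (1 - a * s)) MeasureTheory.volume t 1 :=
    (ContinuousOn.congr (by fun_prop) hright).intervalIntegrable
  rw [← integral_add_adjacent_intervals hint_left hint_right, integral_congr hleft,
    integral_congr hright, integral_mul_const, integral_const_mul,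
    integral_sub (by simp) (Continuous.intervalIntegrable (by fun_prop) _ _), integral_const_mul]
  simp only [integral_id, integral_const, smul_eq_mul]
  ring

/-- With `c ≥ 0`, `d ≥ 0` and `c + d > 0`, one has
`sup_{t∈[0,1]} ∫₀¹ k(t,s) ds = (c + 2d)² / (8·(c + d)²)`. -/
theorem stmt_16 (c d : ℝ) (hc : 0 ≤ c) (hd : 0 ≤ d) (hcd : 0 < c + d)
    (k : ℝ → ℝ → ℝ)
    (hk : ∀ t s, k t s =
      if s ≤ t then s * (1 - c * t / (c + d)) else t * (1 - c * s / (c + d))) :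
    sSup ((fun t => ∫ s in (0:ℝ)..1, k t s) '' Set.Icc (0:ℝ) 1) =
      (c + 2 * d)^2 / (8 * (c + d)^2) := by
  have hvalue : ∀ t ∈ Set.Icc (0 : ℝ) 1,
      (∫ s in (0 : ℝ)..1, k t s) = (1 - c / (c + d) / 2) * t - t ^ 2 / 2 := by
    intro t ht
    simp only [hk, mul_div_right_comm]
    exact integral_min_sub_mul _ t ht
  have ha_nonneg : 0 ≤ c / (c + d) := by positivity
  have ha_le : c / (c + d) ≤ 1 := (div_le_one hcd).2 (by linarith)
  have hmax : (c + 2 * d) ^ 2 / (8 * (c + d) ^ 2) = (1 - c / (c + d) / 2) ^ 2 / 2 := by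
    field_simp
    ring
  rw [hmax]
  refine IsGreatest.csSup_eq ⟨⟨1 - c / (c + d) / 2, ?_, ?_⟩, ?_⟩
  · constructor <;> linarith
  · dsimp only
    rw [hvalue _ (by constructor <;> linarith)]
    ring
  · rintro _ ⟨t, ht, rfl⟩
    dsimp only
    rw [hvalue t ht]
    linarith [sq_nonneg (t - (1 - c / (c + d) / 2))]
end

section
/- One has inf_{t∈[1/4,1/2]} ∫_{1/4}^{1/2} k(t,s) ds = (5c + 8d) / (128·(c + d)). -/
/-- Integrating over `[u, v]` a kernel that is `s * (1 - a * t)` below the diagonal and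
`t * (1 - a * s)` above it. -/
lemma integral_green_kernel (a t u v : ℝ) (hu : u ≤ t) (hv : t ≤ v) :
    ∫ s in u..v, (if s ≤ t then s * (1 - a * t) else t * (1 - a * s)) =
      (t ^ 2 - u ^ 2) / 2 * (1 - a * t) + t * ((v - t) - a * ((v ^ 2 - t ^ 2) / 2)) := by
  have hcont : Continuous fun s : ℝ => if s ≤ t then s * (1 - a * t) else t * (1 - a * s) :=
    Continuous.if_le (by fun_prop) (by fun_prop) continuous_id continuous_const
      (by rintro s rfl; rfl)
  rw [← intervalIntegral.integral_add_adjacent_intervals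
    (hcont.intervalIntegrable u t) (hcont.intervalIntegrable t v)]
  congr 1
  · rw [intervalIntegral.integral_congr (g := fun s => s * (1 - a * t)),
      intervalIntegral.integral_mul_const, integral_id]
    intro s hs
    rw [Set.uIcc_of_le hu] at hs
    exact if_pos hs.2
  · rw [intervalIntegral.integral_congr (g := fun s => t * (1 - a * s)),
      intervalIntegral.integral_const_mul, intervalIntegral.integral_sub
        intervalIntegrable_const ((continuous_const_mul a).intervalIntegrable t v),
      intervalIntegral.integral_const_mul, integral_id]
    · simp
    intro s hs
    rw [Set.uIcc_of_le hv] at hs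
    rcases hs.1.eq_or_lt with rfl | h
    · simp
    · exact if_neg h.not_ge

/-- With `c ≥ 0`, `d ≥ 0` and `c + d > 0`, one has
`inf_{t∈[1/4,1/2]} ∫_{1/4}^{1/2} k(t,s) ds = (5c + 8d) / (128·(c + d))`. -/
theorem stmt_17 (c d : ℝ) (hc : 0 ≤ c) (hd : 0 ≤ d) (hcd : 0 < c + d)
    (k : ℝ → ℝ → ℝ)
    (hk : ∀ t s, k t s =
      if s ≤ t then s * (1 - c * t / (c + d)) else t * (1 - c * s / (c + d))) :
    sInf ((fun t => ∫ s in (1/4:ℝ)..(1/2:ℝ), k t s) '' Set.Icc (1/4:ℝ) (1/2)) =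
      (5 * c + 8 * d) / (128 * (c + d)) := by
  obtain ⟨a, ha⟩ : ∃ a, a = c / (c + d) := ⟨_, rfl⟩
  have ha1 : a ≤ 1 := by rw [ha, div_le_one hcd]; linarith
  have hval : (5 * c + 8 * d) / (128 * (c + d)) = 1 / 16 - 3 * a / 128 := by
    rw [ha]; field_simp; ring
  have hint : ∀ t ∈ Set.Icc (1/4:ℝ) (1/2), ∫ s in (1/4:ℝ)..(1/2:ℝ), k t s =
      1 / 16 - 3 * a / 128 + (t - 1 / 4) * (1 / 2 - (t + 1 / 4) / 2 - 3 * a / 32) := by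
    rintro t ⟨h1, h2⟩
    simp only [hk, mul_div_right_comm, ← ha]
    rw [integral_green_kernel a t _ _ h1 h2]
    ring
  rw [hval]
  refine IsLeast.csInf_eq ⟨⟨1 / 4, by norm_num, ?_⟩, ?_⟩
  · simp only [hint (1 / 4) (by norm_num)]
    ring
  · rintro _ ⟨t, ht, rfl⟩
    simp only [hint t ht]
    have := mul_nonneg (sub_nonneg.2 ht.1)
      (show 0 ≤ 1 / 2 - (t + 1 / 4) / 2 - 3 * a / 32 by linarith [ht.2])
    linarith
end
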